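/- Fix real numbers a < b, α ∈ (0,1), β ∈ [0,1], and set γ = α + β(1−α). Let f : (a,b]×ℝ → ℝ be such that t ↦ f(t, z(t)) belongs to C_{1−γ}[a,b] for every z ∈ C_{1−γ}[a,b], and let c, d, e ∈ ℝ with d ≠ 0 and 1 + c/d ≠ 0. Then a function z ∈ C^γ_{1−γ}[a,b] satisfies the boundary value problem D^{α,β}_a z(t) = f(t, z(t)) for all t ∈ (a,b] together with c·lim_{t→a^+}(I^{1−γ}_a z)(t) + d·lim_{t→b^−}(I^{1−γ}_a z)(t) = e, if and only if z satisfies for all t ∈ (a,b] the integral equation z(t) = ((t−a)^{γ−1}/Γ(γ))·(e/(d(1+c/d))) − (1/(1+c/d))·((t−a)^{γ−1}/Γ(γ))·(1/Γ(1−γ+α)) ∫_a^b (b−s)^{α−γ} f(s, z(s)) ds + (1/Γ(α)) ∫_a^t (t−s)^{α−1} f(s, z(s)) ds. -/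

import Mathlib

/-- The Riemann–Liouville fractional integral of order `μ` based at `a`:
`(I^μ_a g)(t) = (1/Γ(μ)) ∫_a^t (t−s)^{μ−1} g(s) ds` for `μ > 0`
(with the usual convention `I⁰_a = id` in the degenerate case `μ = 0`). -/
noncomputable def rlInt (a μ : ℝ) (g : ℝ → ℝ) (t : ℝ) : ℝ :=
  if μ = 0 then g t
  else (1 / Real.Gamma μ) * ∫ s in a..t, (t - s) ^ (μ - 1) * g s

/-- Membership in the weighted space `C_w[a,b]`: `g : (a,b] → ℝ` is such that
`t ↦ (t−a)^w g(t)` extends to a continuous function on `[a,b]`. -/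
def memCw (a b w : ℝ) (g : ℝ → ℝ) : Prop :=
  ∃ G : ℝ → ℝ, ContinuousOn G (Set.Icc a b) ∧
    ∀ t ∈ Set.Ioc a b, G t = (t - a) ^ w * g t

open MeasureTheory Set Filter Topology

lemma beta01 {p q : ℝ} (hp : 0 < p) (hq : 0 < q) :
    IntervalIntegrable (fun x : ℝ => (1 - x) ^ (p - 1) * x ^ (q - 1)) volume 0 1 ∧
    ∫ x in (0:ℝ)..1, (1 - x) ^ (p - 1) * x ^ (q - 1) =
      Real.Gamma p * Real.Gamma q / Real.Gamma (p + q) := by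
  have key : ∀ x ∈ uIcc (0:ℝ) 1, ((x : ℂ) ^ ((q:ℂ) - 1) * (1 - (x : ℂ)) ^ ((p:ℂ) - 1)) =
      (((1 - x) ^ (p - 1) * x ^ (q - 1) : ℝ) : ℂ) := by
    intro x hx
    rw [uIcc_of_le zero_le_one] at hx
    rw [Complex.ofReal_mul, Complex.ofReal_cpow (by linarith [hx.2]), Complex.ofReal_cpow hx.1]
    push_cast
    ring
  have h1 := Complex.betaIntegral_convergent (u := (q:ℂ)) (v := (p:ℂ)) (by simpa) (by simpa)
  have h2 : IntervalIntegrable (fun x : ℝ => (((1 - x) ^ (p - 1) * x ^ (q - 1) : ℝ) : ℂ)) volume 0 1 :=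
    h1.congr (fun x hx => key x (uIoc_subset_uIcc hx))
  constructor
  · rw [intervalIntegrable_iff] at h2 ⊢
    have h4 := h2.re
    simp only [RCLike.re_to_complex, Complex.ofReal_re] at h4
    exact h4
  · have h3 := Complex.betaIntegral_eq_Gamma_mul_div (q:ℂ) (p:ℂ) (by simpa) (by simpa)
    rw [Complex.betaIntegral, intervalIntegral.integral_congr (fun x hx => key x hx),
      intervalIntegral.integral_ofReal] at h3
    apply Complex.ofReal_injective
    rw [h3]
    push_cast [← Complex.Gamma_ofReal]
    rw [mul_comm, add_comm]

lemma subst01 {a t : ℝ} (hat : a < t) (h : ℝ → ℝ) :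
    ∫ s in a..t, h s = (t - a) * ∫ x in (0:ℝ)..1, h (a + (t - a) * x) := by
  have := intervalIntegral.integral_comp_mul_add (a := 0) (b := 1) h (c := t - a) (by linarith) a
  have e : ∀ x, a + (t - a) * x = (t - a) * x + a := fun x => by ring
  simp only [e]
  rw [this]
  have : t - a ≠ 0 := by linarith
  simp [this]

lemma betaInt {p q r t : ℝ} (hp : 0 < p) (hq : 0 < q) (hrt : r < t) :
    IntervalIntegrable (fun x : ℝ => (t - x) ^ (p - 1) * (x - r) ^ (q - 1)) volume r t ∧
    ∫ x in r..t, (t - x) ^ (p - 1) * (x - r) ^ (q - 1) =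
      (t - r) ^ (p + q - 1) * (Real.Gamma p * Real.Gamma q / Real.Gamma (p + q)) := by
  have hc : 0 < t - r := by linarith
  constructor
  · have h := ((beta01 hp hq).1.comp_mul_right (c := (t - r)⁻¹)).comp_sub_right r
    simp only [zero_div, zero_add, one_div, inv_inv, sub_add_cancel] at h
    have h' := h.const_mul ((t - r) ^ (p - 1) * (t - r) ^ (q - 1))
    refine h'.congr fun x hx => ?_
    rw [uIoc_of_le hrt.le] at hx
    have e1 : 1 - (x - r) * (t - r)⁻¹ = (t - x) / (t - r) := by field_simp; ring
    simp only [e1]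
    rw [← div_eq_mul_inv, Real.div_rpow (by linarith [hx.2]) hc.le, Real.div_rpow (by linarith [hx.1]) hc.le]
    have := (Real.rpow_pos_of_pos hc (p-1)).ne'
    have := (Real.rpow_pos_of_pos hc (q-1)).ne'
    field_simp
  · rw [subst01 hrt, ← (beta01 hp hq).2]
    have : ∀ x ∈ uIcc (0:ℝ) 1, (t - (r + (t - r) * x)) ^ (p - 1) * (r + (t - r) * x - r) ^ (q - 1)
      = ((t - r) ^ (p - 1) * (t - r) ^ (q - 1)) * ((1 - x) ^ (p - 1) * x ^ (q - 1)) := by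
      intro x hx
      rw [uIcc_of_le zero_le_one] at hx
      have e1 : t - (r + (t - r) * x) = (t - r) * (1 - x) := by ring
      have e2 : r + (t - r) * x - r = (t - r) * x := by ring
      rw [e1, e2, Real.mul_rpow hc.le (by linarith [hx.2]), Real.mul_rpow hc.le hx.1]
      ring
    rw [intervalIntegral.integral_congr this, intervalIntegral.integral_const_mul, ← mul_assoc]
    congr 1
    have e3 : p + q - 1 = 1 + (p - 1 + (q - 1)) := by ring
    rw [← Real.rpow_add hc, e3, Real.rpow_add hc 1, Real.rpow_one]

lemma memCw.rep {a b w : ℝ} {g : ℝ → ℝ} (h : memCw a b w g) :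
    ∃ G : ℝ → ℝ, Continuous G ∧ (∃ M, ∀ x, |G x| ≤ M) ∧ ∀ t ∈ Ioc a b, g t = (t - a) ^ (-w) * G t := by
  obtain ⟨G, hG, hGt⟩ := h
  rcases le_or_gt a b with hab | hab
  · refine ⟨IccExtend hab ((Icc a b).domRestrict G), ?_, ?_, ?_⟩
    · exact (continuousOn_iff_continuous_domRestrict.1 hG).Icc_extend'
    · obtain ⟨M, hM⟩ := isCompact_Icc.exists_bound_of_continuousOn hG
      refine ⟨M, fun x => ?_⟩
      exact hM _ (projIcc a b hab x).2
    · intro t ht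
      have hp : 0 < t - a := by linarith [ht.1]
      rw [IccExtend_of_mem hab _ ⟨ht.1.le, ht.2⟩, domRestrict_apply, hGt t ht, ← mul_assoc,
        ← Real.rpow_add hp]
      simp
  · exact ⟨0, continuous_const, ⟨0, by simp⟩, fun t ht => by linarith [ht.1, ht.2]⟩

lemma memCw.contOn {a b w : ℝ} {g : ℝ → ℝ} (h : memCw a b w g) : ContinuousOn g (Ioc a b) := by
  obtain ⟨G, hG, _, hGt⟩ := h.rep
  refine ContinuousOn.congr ?_ hGt
  refine ContinuousOn.mul ?_ hG.continuousOn
  intro t ht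
  refine ContinuousAt.continuousWithinAt ?_
  exact ContinuousAt.rpow_const (by fun_prop) (Or.inl (by linarith [ht.1]))

lemma memCw.mono {a b w w' : ℝ} {g : ℝ → ℝ} (h : memCw a b w g) (hw : w ≤ w') : memCw a b w' g := by
  obtain ⟨G, hG, hGt⟩ := h
  refine ⟨fun t => (t - a) ^ (w' - w) * G t, ?_, ?_⟩
  · refine ContinuousOn.mul ?_ hG
    exact (Continuous.rpow_const (by fun_prop) (fun x => Or.inr (by linarith))).continuousOn
  · intro t ht
    have hp : 0 < t - a := by linarith [ht.1]
    simp only [hGt t ht]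
    rw [← mul_assoc, ← Real.rpow_add hp]
    simp

lemma memCw.add {a b w : ℝ} {g h : ℝ → ℝ} (hg : memCw a b w g) (hh : memCw a b w h) :
    memCw a b w (fun t => g t + h t) := by
  obtain ⟨G, hG, hGt⟩ := hg
  obtain ⟨H, hH, hHt⟩ := hh
  exact ⟨fun t => G t + H t, hG.add hH, fun t ht => by simp only [hGt t ht, hHt t ht]; ring⟩

lemma memCw_pow (a b w K : ℝ) : memCw a b w (fun t => K * (t - a) ^ (-w)) := by
  refine ⟨fun _ => K, continuousOn_const, fun t ht => ?_⟩
  have hp : 0 < t - a := by linarith [ht.1]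
  rw [mul_left_comm, ← Real.rpow_add hp]
  simp

lemma rl_int {a b w μ t : ℝ} {g : ℝ → ℝ} (hg : memCw a b w g) (hw : w < 1) (hμ : 0 < μ)
    (ht : t ∈ Ioc a b) : IntervalIntegrable (fun s => (t - s) ^ (μ - 1) * g s) volume a t := by
  obtain ⟨G, hG, _, hGt⟩ := hg.rep
  have h := (betaInt hμ (sub_pos.2 hw) ht.1).1.mul_continuousOn (g := G) hG.continuousOn
  refine h.congr fun s hs => ?_
  rw [uIoc_of_le ht.1.le] at hs
  simp only [hGt s ⟨hs.1, hs.2.trans ht.2⟩]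
  rw [mul_assoc]
  congr 3; ring

lemma rl_scale {a b w μ t : ℝ} {g G : ℝ → ℝ} (hμ : 0 < μ)
    (hG : ∀ t ∈ Ioc a b, g t = (t - a) ^ (-w) * G t) (ht : t ∈ Ioc a b) :
    rlInt a μ g t = (t - a) ^ (μ - w) * ((1 / Real.Gamma μ) *
      ∫ x in (0:ℝ)..1, (1 - x) ^ (μ - 1) * x ^ (-w) * G (a + (t - a) * x)) := by
  have hc : 0 < t - a := by linarith [ht.1]
  rw [rlInt, if_neg hμ.ne', subst01 ht.1]
  have : ∀ x ∈ uIoc (0:ℝ) 1, (t - (a + (t - a) * x)) ^ (μ - 1) * g (a + (t - a) * x)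
      = ((t - a) ^ (μ - 1) * (t - a) ^ (-w)) * ((1 - x) ^ (μ - 1) * x ^ (-w) * G (a + (t - a) * x)) := by
    intro x hx
    rw [uIoc_of_le zero_le_one] at hx
    have e1 : t - (a + (t - a) * x) = (t - a) * (1 - x) := by ring
    have e2 : a + (t - a) * x - a = (t - a) * x := by ring
    rw [hG (a + (t - a) * x) ⟨by nlinarith [hx.1], by nlinarith [hx.2, ht.2]⟩, e1, e2,
      Real.mul_rpow hc.le (by linarith [hx.2]), Real.mul_rpow hc.le hx.1.le]
    ring
  rw [intervalIntegral.integral_congr_ae (Eventually.of_forall this), intervalIntegral.integral_const_mul,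
    ← Real.rpow_add hc]
  have e3 : μ - w = 1 + (μ - 1 + -w) := by ring
  rw [e3, Real.rpow_add hc 1, Real.rpow_one]
  ring

lemma memCw.rl {a b w μ : ℝ} {g : ℝ → ℝ} (hg : memCw a b w g) (hw : w < 1) (hμ : 0 < μ) :
    memCw a b (w - μ) (rlInt a μ g) := by
  obtain ⟨G, hG, ⟨M, hM⟩, hGt⟩ := hg.rep
  refine ⟨fun t => (1 / Real.Gamma μ) *
      ∫ x in (0:ℝ)..1, (1 - x) ^ (μ - 1) * x ^ (-w) * G (a + (t - a) * x), ?_, ?_⟩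
  · refine (Continuous.mul continuous_const ?_).continuousOn
    have hb := (beta01 hμ (sub_pos.2 hw)).1
    have ew : 1 - w - 1 = -w := by ring
    rw [ew] at hb
    refine intervalIntegral.continuous_of_dominated_interval
      (bound := fun x => |(1 - x) ^ (μ - 1) * x ^ (-w)| * M) ?_ ?_ ?_ ?_
    · intro t
      refine AEStronglyMeasurable.mul (intervalIntegrable_iff.1 hb).aestronglyMeasurable ?_
      exact (by fun_prop : Continuous fun x => G (a + (t - a) * x)).aestronglyMeasurable
    · intro t
      refine Eventually.of_forall fun x _ => ?_
      rw [norm_mul, Real.norm_eq_abs, Real.norm_eq_abs]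
      exact mul_le_mul_of_nonneg_left (hM _) (abs_nonneg _)
    · exact hb.abs.mul_const M
    · refine Eventually.of_forall fun x _ => ?_
      fun_prop
  · intro t ht
    have hc : 0 < t - a := by linarith [ht.1]
    simp only
    rw [rl_scale hμ hGt ht, ← mul_assoc ((t - a) ^ (w - μ)), ← Real.rpow_add hc]
    simp

lemma rl_semigroup_pos {a b w μ ν t : ℝ} {g : ℝ → ℝ} (hg : memCw a b w g) (hw : w < 1)
    (hμ : 0 < μ) (hν : 0 < ν) (ht : t ∈ Ioc a b) :
    rlInt a μ (rlInt a ν g) t = rlInt a (μ + ν) g t := by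
  have hμν : 0 < μ + ν := add_pos hμ hν
  set ρ := (volume : Measure ℝ).restrict (Ioo a t) with hρ
  set K : ℝ → ℝ → ℝ := fun s r => if r < s then (t - s) ^ (μ - 1) * (s - r) ^ (ν - 1) * g r else 0 with hK
  have hint : ∀ (u v : ℝ) (_ : u ≤ v) (h : ℝ → ℝ), ∫ s in u..v, h s = ∫ s in Ioo u v, h s := by
    intro u v huv h
    rw [intervalIntegral.integral_of_le huv, integral_Ioc_eq_integral_Ioo]
  have hK1 : ∀ s ∈ Ioo a t, ∫ r, K s r ∂ρ = (t - s) ^ (μ - 1) * ∫ r in a..s, (s - r) ^ (ν - 1) * g r := by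
    intro s hs
    have e : (fun r => K s r) = (Iio s).indicator (fun r => (t - s) ^ (μ - 1) * ((s - r) ^ (ν - 1) * g r)) := by
      ext r
      simp only [hK, indicator, mem_Iio, mul_assoc]
    have e2 : Ioo a t ∩ Iio s = Ioo a s := by
      ext r; simp only [mem_inter_iff, mem_Ioo, mem_Iio]
      exact ⟨fun h => ⟨h.1.1, h.2⟩, fun h => ⟨⟨h.1, h.2.trans hs.2⟩, h.2⟩⟩
    rw [e, hρ, setIntegral_indicator measurableSet_Iio, e2, hint _ _ hs.1.le, integral_const_mul]
  have hpre : ∀ r ∈ Ioo a t, Ioo a t ∩ Ioi r = Ioo r t := by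
    intro r hr
    ext s; simp only [mem_inter_iff, mem_Ioo, mem_Ioi]
    exact ⟨fun h => ⟨h.2, h.1.2⟩, fun h => ⟨⟨hr.1.trans h.1, h.2⟩, h.1⟩⟩
  have hKind : ∀ r, (fun s => K s r) = (Ioi r).indicator (fun s => (t - s) ^ (μ - 1) * (s - r) ^ (ν - 1) * g r) := by
    intro r; ext s
    simp only [hK, indicator, mem_Ioi]
  have hK2 : ∀ r ∈ Ioo a t, ∫ s, K s r ∂ρ = (t - r) ^ (μ + ν - 1) *
      (Real.Gamma μ * Real.Gamma ν / Real.Gamma (μ + ν)) * g r := by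
    intro r hr
    rw [hKind, hρ, setIntegral_indicator measurableSet_Ioi, hpre r hr, integral_mul_const,
      ← hint _ _ hr.2.le, (betaInt hμ hν hr.2).2]
  have hK3 : ∀ r ∈ Ioo a t, Integrable (fun s => K s r) ρ := by
    intro r hr
    rw [hKind, hρ]
    rw [integrable_indicator_iff measurableSet_Ioi, IntegrableOn, Measure.restrict_restrict measurableSet_Ioi,
      inter_comm, hpre r hr]
    have h := (betaInt hμ hν hr.2).1
    rw [intervalIntegrable_iff_integrableOn_Ioo_of_le hr.2.le] at h
    exact Integrable.mul_const h _
  have hK4 : ∀ r ∈ Ioo a t, ∫ s, ‖K s r‖ ∂ρ = (t - r) ^ (μ + ν - 1) *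
      (Real.Gamma μ * Real.Gamma ν / Real.Gamma (μ + ν)) * |g r| := by
    intro r hr
    have e : ∀ s ∈ Ioo a t, ‖K s r‖ =
        (Ioi r).indicator (fun s => (t - s) ^ (μ - 1) * (s - r) ^ (ν - 1) * |g r|) s := by
      intro s hs
      simp only [hK, indicator, mem_Ioi]
      split_ifs with h
      · rw [norm_mul, norm_mul, Real.norm_eq_abs, Real.norm_eq_abs, Real.norm_eq_abs,
          abs_of_nonneg (Real.rpow_nonneg (by linarith [hs.2]) _),
          abs_of_nonneg (Real.rpow_nonneg (by linarith) _)]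
      · simp
    rw [hρ, setIntegral_congr_fun measurableSet_Ioo e, setIntegral_indicator measurableSet_Ioi,
      hpre r hr, integral_mul_const, ← hint _ _ hr.2.le, (betaInt hμ hν hr.2).2]
  have hmem : ∀ᵐ r ∂ρ, r ∈ Ioo a t := ae_restrict_mem measurableSet_Ioo
  have hgm : AEStronglyMeasurable g ρ :=
    (hg.contOn.mono (fun x hx => ⟨hx.1, hx.2.le.trans ht.2⟩)).aestronglyMeasurable measurableSet_Ioo
  have hmeas : AEStronglyMeasurable (Function.uncurry K) (ρ.prod ρ) := by
    have e : Function.uncurry K = {p : ℝ × ℝ | p.2 < p.1}.indicator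
        (fun p => (t - p.1) ^ (μ - 1) * (p.1 - p.2) ^ (ν - 1) * g p.2) := by
      ext p
      simp only [hK, indicator, Function.uncurry, mem_ofPred_eq]
    rw [e]
    refine AEStronglyMeasurable.indicator ?_ (measurableSet_lt measurable_snd measurable_fst)
    refine AEStronglyMeasurable.mul ?_ hgm.comp_snd
    exact Measurable.aestronglyMeasurable (by fun_prop)
  have hI : Integrable (Function.uncurry K) (ρ.prod ρ) := by
    rw [integrable_prod_iff' hmeas]
    refine ⟨hmem.mono hK3, ?_⟩
    have h := (rl_int hg hw hμν ht).abs
    rw [intervalIntegrable_iff_integrableOn_Ioo_of_le ht.1.le] at h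
    have h2 := Integrable.const_mul h (Real.Gamma μ * Real.Gamma ν / Real.Gamma (μ + ν))
    refine h2.congr ?_
    filter_upwards [hmem] with r hr
    simp only [Function.uncurry]
    rw [hK4 r hr, abs_mul, abs_of_nonneg (Real.rpow_nonneg (by linarith [hr.2]) _)]
    ring
  have hswap := integral_integral_swap hI
  rw [integral_congr_ae (hmem.mono hK1), integral_congr_ae (hmem.mono hK2)] at hswap
  simp only [rlInt, if_neg hμ.ne', if_neg hν.ne', if_neg hμν.ne']
  rw [hint _ _ ht.1.le, hint _ _ ht.1.le]
  have e1 : ∀ s, (t - s) ^ (μ - 1) * (1 / Real.Gamma ν * ∫ r in a..s, (s - r) ^ (ν - 1) * g r)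
     = (1 / Real.Gamma ν) * ((t - s) ^ (μ - 1) * ∫ r in a..s, (s - r) ^ (ν - 1) * g r) := fun s => by ring
  have e2 : ∀ s, (t - s) ^ (μ + ν - 1) * (Real.Gamma μ * Real.Gamma ν / Real.Gamma (μ + ν)) * g s
    = (Real.Gamma μ * Real.Gamma ν / Real.Gamma (μ + ν)) * ((t - s) ^ (μ + ν - 1) * g s) := fun s => by ring
  simp only [e1]
  simp only [e2] at hswap
  rw [integral_const_mul, hswap, integral_const_mul]
  have := (Real.Gamma_pos_of_pos hμ).ne'
  have := (Real.Gamma_pos_of_pos hν).ne'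
  have := (Real.Gamma_pos_of_pos hμν).ne'
  field_simp
  rfl

lemma rl_congr {a b μ t : ℝ} {g h : ℝ → ℝ} (hgh : ∀ s ∈ Ioc a b, g s = h s) (ht : t ∈ Ioc a b) :
    rlInt a μ g t = rlInt a μ h t := by
  unfold rlInt
  split_ifs
  · exact hgh t ht
  · congr 1
    refine intervalIntegral.integral_congr_ae (Eventually.of_forall fun s hs => ?_)
    rw [uIoc_of_le ht.1.le] at hs
    simp only [hgh s ⟨hs.1, hs.2.trans ht.2⟩]

lemma rl_zero (a : ℝ) (g : ℝ → ℝ) : rlInt a 0 g = g := by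
  ext t; simp [rlInt]

lemma rl_one (a : ℝ) (g : ℝ → ℝ) (t : ℝ) : rlInt a 1 g t = ∫ s in a..t, g s := by
  simp [rlInt]

lemma rl_semigroup {a b w μ ν t : ℝ} {g : ℝ → ℝ} (hg : memCw a b w g) (hw : w < 1)
    (hμ : 0 ≤ μ) (hν : 0 ≤ ν) (ht : t ∈ Ioc a b) :
    rlInt a μ (rlInt a ν g) t = rlInt a (μ + ν) g t := by
  rcases hμ.eq_or_lt with rfl | hμ
  · rw [rl_zero, zero_add]
  rcases hν.eq_or_lt with rfl | hν
  · rw [rl_zero, add_zero]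
  exact rl_semigroup_pos hg hw hμ hν ht

lemma rl_add {a b w μ t : ℝ} {g h : ℝ → ℝ} (hg : memCw a b w g) (hh : memCw a b w h) (hw : w < 1)
    (hμ : 0 ≤ μ) (ht : t ∈ Ioc a b) :
    rlInt a μ (fun s => g s + h s) t = rlInt a μ g t + rlInt a μ h t := by
  rcases hμ.eq_or_lt with rfl | hμ
  · simp [rl_zero]
  simp only [rlInt, if_neg hμ.ne', mul_add]
  rw [intervalIntegral.integral_add (rl_int hg hw hμ ht) (rl_int hh hw hμ ht)]
  ring

lemma rl_pow {a t γ : ℝ} (K : ℝ) (hγ0 : 0 < γ) (hγ1 : γ ≤ 1) (ht : a < t) :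
    rlInt a (1 - γ) (fun s => K / Real.Gamma γ * (s - a) ^ (-(1 - γ))) t = K := by
  have hG := (Real.Gamma_pos_of_pos hγ0).ne'
  rcases hγ1.eq_or_lt with rfl | hγ1
  · simp [rl_zero]
  have h1 : 0 < 1 - γ := by linarith
  have hG1 := (Real.Gamma_pos_of_pos h1).ne'
  have hb := (betaInt h1 hγ0 ht).2
  have e : ∀ s, (t - s) ^ (1 - γ - 1) * (K / Real.Gamma γ * (s - a) ^ (-(1 - γ)))
     = K / Real.Gamma γ * ((t - s) ^ (1 - γ - 1) * (s - a) ^ (γ - 1)) := fun s => by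
    rw [neg_sub]; ring
  simp only [rlInt, if_neg h1.ne', e]
  rw [intervalIntegral.integral_const_mul, hb]
  simp
  field_simp

lemma rl_one_inj {a b w : ℝ} {g h : ℝ → ℝ} (hg : memCw a b w g) (hh : memCw a b w h) (hw : w < 1)
    (H : ∀ t ∈ Ioc a b, rlInt a 1 g t = rlInt a 1 h t) : ∀ t ∈ Ioc a b, g t = h t := by
  intro t ht
  have hd : ∀ k : ℝ → ℝ, memCw a b w k → HasDerivWithinAt (rlInt a 1 k) (k t) (Iic t) t := by
    intro k hk
    have hi : IntervalIntegrable k volume a t := by simpa using rl_int hk hw one_pos ht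
    have hnhds : Ioc a b ∈ 𝓝[≤] t :=
      mem_of_superset (Ioc_mem_nhdsLE ht.1) (Ioc_subset_Ioc_right ht.2)
    have hc : ContinuousWithinAt k (Iic t) t :=
      (hk.contOn t ht).mono_of_mem_nhdsWithin hnhds
    have hm : StronglyMeasurableAtFilter k (𝓝[≤] t) volume :=
      ⟨Ioc a b, hnhds, hk.contOn.aestronglyMeasurable measurableSet_Ioc⟩
    have := intervalIntegral.integral_hasDerivWithinAt_right hi (s := Iic t) (t := Iic t) hm hc
    rw [funext (rl_one a k)]
    exact this
  have h1 := hd g hg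
  have h2 := hd h hh
  have h3 : HasDerivWithinAt (rlInt a 1 h) (g t) (Iic t) t := by
    refine h1.congr_of_eventuallyEq ?_ (H t ht).symm
    filter_upwards [Ioc_mem_nhdsLE ht.1] with s hs
    exact (H s ⟨hs.1, hs.2.trans ht.2⟩).symm
  exact (uniqueDiffWithinAt_Iic t).eq_deriv _ h3 h2

lemma rl_inj {a b w μ : ℝ} {g h : ℝ → ℝ} (hg : memCw a b w g) (hh : memCw a b w h) (hw : w < 1)
    (hμ0 : 0 ≤ μ) (hμ1 : μ ≤ 1)
    (H : ∀ t ∈ Ioc a b, rlInt a μ g t = rlInt a μ h t) : ∀ t ∈ Ioc a b, g t = h t := by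
  refine rl_one_inj hg hh hw fun t ht => ?_
  have h1 := rl_congr (μ := 1 - μ) H ht
  rw [rl_semigroup hg hw (by linarith) hμ0 ht, rl_semigroup hh hw (by linarith) hμ0 ht] at h1
  simpa using h1

lemma memCw.tendsto {a b w : ℝ} {g : ℝ → ℝ} (hab : a < b) (hg : memCw a b w g) (hw : w ≤ 0) :
    ∃ L, Tendsto g (𝓝[>] a) (𝓝 L) ∧ (w < 0 → L = 0) := by
  obtain ⟨G, hG, _, hGt⟩ := hg.rep
  have hcont : Continuous (fun t => (t - a) ^ (-w) * G t) :=
    (Continuous.rpow_const (by fun_prop) (fun x => Or.inr (by linarith))).mul hG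
  refine ⟨(a - a) ^ (-w) * G a, ?_, ?_⟩
  · have h := (hcont.tendsto a).mono_left (nhdsWithin_le_nhds (s := Ioi a))
    refine h.congr' ?_
    filter_upwards [Ioc_mem_nhdsGT hab] with t ht
    exact (hGt t ht).symm
  · intro h
    rw [sub_self, Real.zero_rpow (by linarith), zero_mul]

lemma memCw.rl0 {a b w μ : ℝ} {g : ℝ → ℝ} (hg : memCw a b w g) (hw : w < 1) (hμ : 0 ≤ μ) :
    memCw a b (w - μ) (rlInt a μ g) := by
  rcases hμ.eq_or_lt with rfl | hμ
  · rwa [rl_zero, sub_zero]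
  · exact hg.rl hw hμ

/-- **Equivalence of the Hilfer BVP with an integral equation (Lemma 3.1).**
Fix `a < b`, `α ∈ (0,1)`, `β ∈ [0,1]`, `γ = α + β(1−α)` (so `(1−β)(1−α) = 1−γ`).
Let `f : (a,b]×ℝ → ℝ` be such that `t ↦ f(t,z(t)) ∈ C_{1−γ}[a,b]` for every
`z ∈ C_{1−γ}[a,b]`, and let `c, d, e ∈ ℝ` with `d ≠ 0` and `1 + c/d ≠ 0`.
Let `z ∈ C^γ_{1−γ}[a,b]`, i.e. `z ∈ C_{1−γ}[a,b]`, `I^{1−γ}_a z` is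
differentiable on `(a,b]` with derivative `D^γ_a z = Dz`, and
`Dz ∈ C_{1−γ}[a,b]`.  Then `z` satisfies the Hilfer BVP
`D^{α,β}_a z(t) = I^{β(1−α)}_a Dz(t) = f(t,z(t))` on `(a,b]` together with the
boundary condition `c·lim_{t→a⁺}(I^{1−γ}_a z)(t) + d·lim_{t→b⁻}(I^{1−γ}_a z)(t) = e`,
iff `z` satisfies the integral equation stated below on `(a,b]`. -/
theorem hilfer_bvp_iff_integral_equation (a b α β γ : ℝ) (hab : a < b)
    (hα0 : 0 < α) (hα1 : α < 1) (hβ0 : 0 ≤ β) (hβ1 : β ≤ 1)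
    (hγ : γ = α + β * (1 - α))
    (f : ℝ → ℝ → ℝ)
    (hf : ∀ z : ℝ → ℝ, memCw a b (1 - γ) z → memCw a b (1 - γ) (fun t => f t (z t)))
    (c d e : ℝ) (hd : d ≠ 0) (hcd : 1 + c / d ≠ 0)
    (z Dz : ℝ → ℝ)
    (hz : memCw a b (1 - γ) z)
    (hderiv : ∀ t ∈ Set.Ioc a b, HasDerivAt (rlInt a (1 - γ) z) (Dz t) t)
    (hDz : memCw a b (1 - γ) Dz) :
    ((∀ t ∈ Set.Ioc a b, rlInt a (β * (1 - α)) Dz t = f t (z t)) ∧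
        ∃ La Lb : ℝ,
          Filter.Tendsto (rlInt a (1 - γ) z) (nhdsWithin a (Set.Ioi a)) (nhds La) ∧
          Filter.Tendsto (rlInt a (1 - γ) z) (nhdsWithin b (Set.Iio b)) (nhds Lb) ∧
          c * La + d * Lb = e) ↔
      (∀ t ∈ Set.Ioc a b,
        z t = (t - a) ^ (γ - 1) / Real.Gamma γ * (e / (d * (1 + c / d))) -
            (1 / (1 + c / d)) * ((t - a) ^ (γ - 1) / Real.Gamma γ) *
              ((1 / Real.Gamma (1 - γ + α)) *
                ∫ s in a..b, (b - s) ^ (α - γ) * f s (z s)) +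
            (1 / Real.Gamma α) * ∫ s in a..t, (t - s) ^ (α - 1) * f s (z s)) := by
  have hγ0 : 0 < γ := by nlinarith
  have hγ1 : γ ≤ 1 := by nlinarith
  have hαγ : α ≤ γ := by nlinarith
  have eβ : β * (1 - α) = γ - α := by linarith
  rw [eβ]
  have hw : 1 - γ < 1 := by linarith
  set φ : ℝ → ℝ := fun t => f t (z t) with hφdef
  have hφ : memCw a b (1 - γ) φ := hf z hz
  have hF : memCw a b (1 - γ - (1 - γ)) (rlInt a (1 - γ) z) := hz.rl0 hw (by linarith)
  obtain ⟨La, hLa, -⟩ := hF.tendsto hab (by linarith)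
  have hbmem : b ∈ Ioc a b := ⟨hab, le_rfl⟩
  have hLb : Tendsto (rlInt a (1 - γ) z) (𝓝[<] b) (𝓝 (rlInt a (1 - γ) z b)) :=
    (hderiv b hbmem).continuousAt.tendsto.mono_left nhdsWithin_le_nhds
  -- fundamental theorem of calculus
  have hFTC : ∀ t ∈ Ioc a b, rlInt a (1 - γ) z t = La + rlInt a 1 Dz t := by
    intro t ht
    have hi : IntervalIntegrable Dz volume a t := by simpa using rl_int hDz hw one_pos ht
    have := intervalIntegral.integral_eq_sub_of_hasDerivAt_of_tendsto ht.1
      (fun x hx => hderiv x ⟨hx.1, hx.2.le.trans ht.2⟩) hi hLa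
      ((hderiv t ht).continuousAt.tendsto.mono_left nhdsWithin_le_nhds)
    rw [rl_one, this]; ring
  have hμ : 0 < 1 - γ + α := by linarith
  -- the image of the right-hand side under the fractional integral of order `1 - γ`
  have hR : ∀ K : ℝ, memCw a b (1 - γ)
      (fun t => K / Real.Gamma γ * (t - a) ^ (-(1 - γ)) + rlInt a α φ t) := fun K =>
    (memCw_pow a b (1 - γ) (K / Real.Gamma γ)).add ((hφ.rl0 hw hα0.le).mono (by linarith))
  have hRI : ∀ K : ℝ, ∀ t ∈ Ioc a b, rlInt a (1 - γ)
      (fun t => K / Real.Gamma γ * (t - a) ^ (-(1 - γ)) + rlInt a α φ t) t =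
        K + rlInt a (1 - γ + α) φ t := by
    intro K t ht
    rw [rl_add (memCw_pow a b (1 - γ) (K / Real.Gamma γ))
      ((hφ.rl0 hw hα0.le).mono (by linarith)) hw (by linarith) ht, rl_pow K hγ0 hγ1 ht.1,
      rl_semigroup hφ hw (by linarith) hα0.le ht]
  have hDI : ∀ t ∈ Ioc a b, rlInt a (1 - γ + α) (rlInt a (γ - α) Dz) t = rlInt a 1 Dz t := by
    intro t ht
    rw [rl_semigroup hDz hw hμ.le (by linarith) ht]
    congr 1; ring
  have hDm : memCw a b (1 - γ) (rlInt a (γ - α) Dz) := (hDz.rl0 hw (by linarith)).mono (by linarith)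
  have hne : c + d ≠ 0 := by
    intro h
    apply hcd
    field_simp
    linarith
  -- rewriting the right-hand side of the integral equation
  set K₀ : ℝ := e / (d * (1 + c / d)) - (1 / (1 + c / d)) * rlInt a (1 - γ + α) φ b with hK₀
  have hK₀' : K₀ = (e - d * rlInt a (1 - γ + α) φ b) / (c + d) := by
    have h1 : 1 + c / d = (c + d) / d := by field_simp; ring
    rw [hK₀, h1]
    field_simp
  have hrhs : ∀ t, (t - a) ^ (γ - 1) / Real.Gamma γ * (e / (d * (1 + c / d))) -
            (1 / (1 + c / d)) * ((t - a) ^ (γ - 1) / Real.Gamma γ) *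
              ((1 / Real.Gamma (1 - γ + α)) *
                ∫ s in a..b, (b - s) ^ (α - γ) * f s (z s)) +
            (1 / Real.Gamma α) * ∫ s in a..t, (t - s) ^ (α - 1) * f s (z s)
      = K₀ / Real.Gamma γ * (t - a) ^ (-(1 - γ)) + rlInt a α φ t := by
    intro t
    have e1 : (1 / Real.Gamma (1 - γ + α)) * ∫ s in a..b, (b - s) ^ (α - γ) * f s (z s)
        = rlInt a (1 - γ + α) φ b := by
      rw [rlInt, if_neg hμ.ne']
      have : 1 - γ + α - 1 = α - γ := by ring
      rw [this]
    have e2 : (1 / Real.Gamma α) * ∫ s in a..t, (t - s) ^ (α - 1) * f s (z s) = rlInt a α φ t := by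
      rw [rlInt, if_neg hα0.ne']
    rw [e1, e2, neg_sub, hK₀]
    ring
  simp only [hrhs]
  constructor
  · rintro ⟨hD, La', Lb', hLa', hLb', hbc⟩
    obtain rfl := tendsto_nhds_unique hLa' hLa
    obtain rfl := tendsto_nhds_unique hLb' hLb
    have hDφ : ∀ t ∈ Ioc a b, rlInt a 1 Dz t = rlInt a (1 - γ + α) φ t := by
      intro t ht
      rw [← hDI t ht]
      exact rl_congr hD ht
    have hLK : La' = K₀ := by
      rw [hFTC b hbmem, hDφ b hbmem] at hbc
      rw [hK₀', eq_div_iff hne]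
      linarith
    rw [← hLK]
    refine rl_inj hz (hR La') hw (by linarith) (by linarith : 1 - γ ≤ 1) fun t ht => ?_
    rw [hRI La' t ht, hFTC t ht, hDφ t ht]
  · intro hzeq
    have hFz : ∀ t ∈ Ioc a b, rlInt a (1 - γ) z t = K₀ + rlInt a (1 - γ + α) φ t := by
      intro t ht
      rw [← hRI K₀ t ht]
      exact rl_congr hzeq ht
    have hLK : La = K₀ := by
      obtain ⟨L, hL, hL0⟩ := (hφ.rl0 hw hμ.le).tendsto hab (by linarith)
      rw [hL0 (by linarith)] at hL
      have h1 := hL.const_add K₀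
      rw [add_zero] at h1
      refine tendsto_nhds_unique hLa (h1.congr' ?_)
      filter_upwards [Ioc_mem_nhdsGT hab] with t ht
      exact (hFz t ht).symm
    refine ⟨?_, La, _, hLa, hLb, ?_⟩
    · refine rl_inj hDm hφ hw hμ.le (by linarith) fun t ht => ?_
      rw [hDI t ht]
      have h1 := hFz t ht
      rw [hFTC t ht, hLK] at h1
      linarith
    · rw [hFz b hbmem, hLK, hK₀']
      field_simp
      ring
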